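/- Let (V,T) and (W,S) be non-degenerate cubic spaces over k, each of dimension ≤ ℵ₀ as k-vector spaces. Then there exist embeddings of cubic spaces W → V and V → W (i.e., V and W are isogenous) if and only if rrk(V,T) = rrk(W,S). -/

import Mathlib

open scoped BigOperators

/-- The submodule of quadratic forms of finite strength: those expressible as a finite
sum of products of two linear forms. -/
def FinStrength (k V : Type*) [Field k] [AddCommGroup V] [Module k V] :
    Submodule k (QuadraticForm k V) where
  carrier := {q | ∃ (n : ℕ) (l m : Fin n → V →ₗ[k] k), ∀ x, q x = ∑ i, l i x * m i x}
  zero_mem' := ⟨0, ![], ![], fun x => by simp⟩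
  add_mem' := by
    rintro q q' ⟨n, l, m, h⟩ ⟨n', l', m', h'⟩
    refine ⟨n + n', Fin.append l l', Fin.append m m', fun x => ?_⟩
    simp [Fin.sum_univ_add, Fin.append_left, Fin.append_right, h, h']
  smul_mem' := by
    rintro c q ⟨n, l, m, h⟩
    refine ⟨n, fun i => c • l i, m, fun x => ?_⟩
    simp [h, Finset.mul_sum, mul_assoc, smul_eq_mul]

/-- For a trilinear form `T` and a vector `v`, the quadratic form `f_v : x ↦ 3 * T v x x`. -/
noncomputable def fQuad {k V : Type*} [Field k] [AddCommGroup V] [Module k V]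
    (T : V →ₗ[k] V →ₗ[k] V →ₗ[k] k) (v : V) : QuadraticForm k V :=
  LinearMap.BilinMap.toQuadraticMap ((3 : k) • T v)

/-- The residual rank of a trilinear form `T`: the dimension of the image of the linear
map `v ↦ class of f_v` in the quotient of the space of quadratic forms by the subspace
of finite-strength quadratic forms. -/
noncomputable def rrk (k : Type*) {V : Type*} [Field k] [AddCommGroup V] [Module k V]
    (T : V →ₗ[k] V →ₗ[k] V →ₗ[k] k) : Cardinal :=
  Module.rank k ↥(Submodule.span k
    (Set.range fun v => Submodule.Quotient.mk (p := FinStrength k V) (fQuad T v)))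

/-- A cubic space `(V,T)` has finite strength if its cubic form `x ↦ T x x x` is a
finite sum of products of a linear form with a quadratic form. -/
def FiniteStrengthCubic (k : Type*) {V : Type*} [Field k] [AddCommGroup V] [Module k V]
    (T : V →ₗ[k] V →ₗ[k] V →ₗ[k] k) : Prop :=
  ∃ (n : ℕ) (l : Fin n → V →ₗ[k] k) (q : Fin n → QuadraticForm k V),
    ∀ x, T x x x = ∑ i, l i x * q i x

universe u v w

/-! ### Finite-codimensional subspaces -/

section FCsec
variable {k V W : Type*} [Field k] [AddCommGroup V] [Module k V] [AddCommGroup W] [Module k W]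

/-- finite codimension -/
def FC (U : Submodule k V) : Prop := Module.Finite k (V ⧸ U)

theorem FC_ker {M : Type*} [AddCommGroup M] [Module k M] [Module.Finite k M] (f : V →ₗ[k] M) :
    FC (LinearMap.ker f) :=
  Module.Finite.equiv f.quotKerEquivRange.symm

theorem FC_top : FC (⊤ : Submodule k V) := by
  have := FC_ker (0 : V →ₗ[k] k)
  rwa [LinearMap.ker_zero] at this

theorem FC_mono {U U' : Submodule k V} (h : U ≤ U') (hU : FC U) : FC U' := by
  unfold FC at *
  exact Module.Finite.of_surjective (Submodule.factor h) (Submodule.factor_surjective h)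

theorem FC_inf {U U' : Submodule k V} (hU : FC U) (hU' : FC U') : FC (U ⊓ U') := by
  unfold FC at hU hU'
  have := FC_ker (U.mkQ.prod U'.mkQ)
  rwa [LinearMap.ker_prod, Submodule.ker_mkQ, Submodule.ker_mkQ] at this

theorem FC_comap {U : Submodule k V} (hU : FC U) (f : W →ₗ[k] V) : FC (U.comap f) := by
  unfold FC at hU
  have := FC_ker (U.mkQ ∘ₗ f)
  rwa [LinearMap.ker_comp, Submodule.ker_mkQ] at this

theorem FC_iInf {ι : Type*} [Finite ι] {U : ι → Submodule k V} (hU : ∀ i, FC (U i)) :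
    FC (⨅ i, U i) := by
  have : ∀ i, Module.Finite k (V ⧸ U i) := hU
  have := FC_ker (LinearMap.pi fun i => (U i).mkQ)
  simpa [LinearMap.ker_pi] using this

theorem FC_decomp {U : Submodule k V} (hU : FC U) :
    ∃ (n : ℕ) (c : Fin n → V) (l : Fin n → V →ₗ[k] k), ∀ x, x - ∑ i, l i x • c i ∈ U := by
  unfold FC at hU
  let b := Module.finBasis k (V ⧸ U)
  choose c hc using fun i => U.mkQ_surjective (b i)
  refine ⟨_, c, fun i => b.coord i ∘ₗ U.mkQ, fun x => ?_⟩
  refine (Submodule.Quotient.mk_eq_zero U).mp ?_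
  change U.mkQ _ = 0
  rw [map_sub, map_sum]
  simp only [map_smul, hc, LinearMap.comp_apply, Module.Basis.coord_apply]
  rw [b.sum_repr, sub_self]

/-- orthogonal of a finitely generated subspace with respect to a bilinear form -/
theorem FC_orth {X : Submodule k V} (hX : X.FG) (B : V →ₗ[k] V →ₗ[k] k) :
    ∃ U : Submodule k V, FC U ∧ ∀ y ∈ U, ∀ x ∈ X, B x y = 0 := by
  have : Module.Finite k X := Module.Finite.iff_fg.mpr hX
  refine ⟨_, FC_ker ((LinearMap.lcomp k k X.subtype) ∘ₗ B.flip), fun y hy x hx => ?_⟩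
  have := LinearMap.congr_fun (LinearMap.mem_ker.mp hy) ⟨x, hx⟩
  simpa using this

theorem FC_not_le {U B : Submodule k V} (hU : FC U) (hB : ¬ FC B) : ∃ x ∈ U, x ∉ B := by
  by_contra! h
  exact hB (FC_mono h hU)

theorem FC_sup_fg {B X : Submodule k V} (hX : X.FG) (h : FC (B ⊔ X)) : FC B := by
  have h' : Module.Finite k (V ⧸ (B ⊔ X)) := h
  have hx : Module.Finite k (X.map B.mkQ) := Module.Finite.iff_fg.mpr (hX.map _)
  have e := Submodule.quotientQuotientEquivQuotientSup B X
  have : Module.Finite k ((V ⧸ B) ⧸ (X.map B.mkQ)) := Module.Finite.equiv e.symm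
  exact Module.Finite.of_submodule_quotient (X.map B.mkQ)

end FCsec

/-! ### The radical subspace and the core lemma -/

section Core
variable {k V : Type*} [Field k] [AddCommGroup V] [Module k V]

/-- vectors `v` such that `T v` has finite rank -/
def V0 (T : V →ₗ[k] V →ₗ[k] V →ₗ[k] k) : Submodule k V where
  carrier := {v | FC (LinearMap.ker (T v))}
  zero_mem' := by
    simp only [Set.mem_ofPred_eq, map_zero, LinearMap.ker_zero]
    exact FC_top
  add_mem' := by
    intro a b ha hb
    refine FC_mono ?_ (FC_inf ha hb)
    intro x hx
    have h1 := LinearMap.mem_ker.mp hx.1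
    have h2 := LinearMap.mem_ker.mp hx.2
    simp [h1, h2]
  smul_mem' := by
    intro c a ha
    refine FC_mono ?_ ha
    intro x hx
    have h1 := LinearMap.mem_ker.mp hx
    simp [h1]

theorem mem_V0 {T : V →ₗ[k] V →ₗ[k] V →ₗ[k] k} {v : V} :
    v ∈ V0 T ↔ FC (LinearMap.ker (T v)) := Iff.rfl

theorem FR_of_vanish (hk2 : (2 : k) ≠ 0) (B : V →ₗ[k] V →ₗ[k] k) (hB : ∀ x y, B x y = B y x)
    {U : Submodule k V} (hU : FC U) (h : ∀ u ∈ U, B u u = 0) : FC (LinearMap.ker B) := by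
  obtain ⟨n, c, l, hcl⟩ := FC_decomp hU
  have hpol : ∀ u ∈ U, ∀ u' ∈ U, B u u' = 0 := by
    intro u hu u' hu'
    have h1 := h _ (U.add_mem hu hu')
    simp only [map_add, LinearMap.add_apply, h u hu, h u' hu', hB u' u] at h1
    have : (2 : k) * B u u' = 0 := by linear_combination h1
    exact (mul_eq_zero.mp this).resolve_left hk2
  have hK : FC (U ⊓ ⨅ i, LinearMap.ker (B.flip (c i))) :=
    FC_inf hU (FC_iInf fun i => FC_ker _)
  refine FC_mono ?_ hK
  intro x hx
  have hx2 : ∀ i, B x (c i) = 0 := by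
    intro i
    have := (Submodule.mem_iInf _).mp hx.2 i
    simpa using this
  rw [LinearMap.mem_ker]
  ext y
  have h1 := hpol x hx.1 _ (hcl y)
  simpa [map_sub, map_sum, hx2] using h1

theorem core [IsAlgClosed k] {ι : Type*} [Finite ι] (B : ι → V →ₗ[k] V →ₗ[k] k)
    (hB : ∀ i x y, B i x y = B i y x) (U : Submodule k V) :
    ∃ (X : Submodule k V) (L : Submodule k (ι → k)), X ≤ U ∧ X.FG ∧
      (∀ a ∈ L, ∃ x ∈ X, ∀ i, B i x x = a i) ∧
      ∀ y ∈ U, (∀ i, ∀ x ∈ X, B i x y = 0) → (fun i => B i y y) ∈ L := by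
  let S : Set (Submodule k (ι → k)) := {L | ∃ X : Submodule k V, X ≤ U ∧ X.FG ∧
      (∀ a ∈ L, ∃ x ∈ X, ∀ i, B i x x = a i)}
  have hS : S.Nonempty := ⟨⊥, ⊥, bot_le, Submodule.fg_bot, fun a ha => ⟨0, by simp, by
    rw [Submodule.mem_bot] at ha; simp [ha]⟩⟩
  obtain ⟨L, ⟨X, hXU, hX, hL⟩, hmax⟩ :=
    WellFounded.has_min (wellFounded_gt (α := Submodule k (ι → k))) S hS
  refine ⟨X, L, hXU, hX, hL, fun y hy hyX => ?_⟩
  by_contra hn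
  refine hmax (L ⊔ Submodule.span k {fun i => B i y y}) ⟨X ⊔ Submodule.span k {y}, ?_, ?_, ?_⟩ ?_
  · refine sup_le hXU ?_
    rw [Submodule.span_singleton_le_iff_mem]; exact hy
  · exact hX.sup (Submodule.fg_span_singleton y)
  · intro a ha
    obtain ⟨a0, ha0, a1, ha1, rfl⟩ := Submodule.mem_sup.mp ha
    obtain ⟨t, rfl⟩ := Submodule.mem_span_singleton.mp ha1
    obtain ⟨s, hs⟩ := IsAlgClosed.exists_pow_nat_eq t (n := 2) (by norm_num)
    obtain ⟨x, hx, hxa⟩ := hL a0 ha0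
    refine ⟨x + s • y, Submodule.add_mem_sup hx
      (Submodule.smul_mem _ _ (Submodule.mem_span_singleton_self y)), fun i => ?_⟩
    have h1 := hyX i x hx
    have h2 := hB i y x
    simp only [map_add, LinearMap.add_apply, map_smul, LinearMap.smul_apply, smul_eq_mul,
      Pi.add_apply, Pi.smul_apply, hxa, h1, h2, ← hs]
    ring
  · refine lt_of_le_of_ne le_sup_left fun h => hn ?_
    rw [h]
    exact Submodule.mem_sup_right (Submodule.mem_span_singleton_self _)

/-- a finite family of forms has a finite-codimensional common orthogonal -/
theorem FC_orth_family {ι : Type*} [Finite ι] {X : Submodule k V} (hX : X.FG)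
    (B : ι → V →ₗ[k] V →ₗ[k] k) :
    ∃ U : Submodule k V, FC U ∧ ∀ y ∈ U, ∀ i, ∀ x ∈ X, B i x y = 0 := by
  choose U hU h using fun i => FC_orth hX (B i)
  exact ⟨⨅ i, U i, FC_iInf hU, fun y hy i x hx => h i y ((Submodule.mem_iInf _).mp hy i) x hx⟩

theorem FC_orth_tri {X : Submodule k V} (hX : X.FG) (T : V →ₗ[k] V →ₗ[k] V →ₗ[k] k) :
    ∃ U : Submodule k V, FC U ∧ ∀ y ∈ U, ∀ x ∈ X, ∀ x' ∈ X, T x x' y = 0 := by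
  have hX' := hX
  obtain ⟨n, s, hs⟩ := Submodule.fg_iff_exists_fin_generating_family.mp hX'
  obtain ⟨U, hU, h⟩ := FC_orth_family hX (fun i => T (s i))
  refine ⟨U, hU, fun y hy x hx x' hx' => ?_⟩
  have hx2 : x ∈ Submodule.span k (Set.range s) := hs ▸ hx
  induction hx2 using Submodule.span_induction with
  | mem x hm =>
    obtain ⟨i, rfl⟩ := hm
    exact h y hy i x' hx'
  | zero => simp
  | add a b ha hb h1 h2 =>
    simp [h1 (hs ▸ ha), h2 (hs ▸ hb)]
  | smul c a ha h1 => simp [h1 (hs ▸ ha)]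

/-- (B): common zeros of finitely many quadratic forms with nonzero cubic value -/
theorem exists_zero_quad [IsAlgClosed k] (hk2 : (2 : k) ≠ 0) {ι : Type*} [Finite ι]
    (B : ι → V →ₗ[k] V →ₗ[k] k)
    (hB : ∀ i x y, B i x y = B i y x) (T : V →ₗ[k] V →ₗ[k] V →ₗ[k] k)
    (hT1 : ∀ x y z, T x y z = T y x z) (hT2 : ∀ x y z, T x y z = T x z y)
    (hT : ∀ U : Submodule k V, FC U → ∃ x ∈ U, T x x x ≠ 0)
    {U : Submodule k V} (hU : FC U) : ∃ y ∈ U, (∀ i, B i y y = 0) ∧ T y y y ≠ 0 := by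
  obtain ⟨X, L, hXU, hX, hL, h⟩ := core B hB U
  obtain ⟨U1, hU1, h1⟩ := FC_orth_family hX B
  obtain ⟨U2, hU2, h2⟩ := FC_orth_tri hX T
  obtain ⟨y, hy, hTy⟩ := hT _ (FC_inf hU (FC_inf hU1 hU2))
  obtain ⟨x, hx, hxy⟩ := hL _ (L.neg_mem (h y hy.1 (h1 y hy.2.1)))
  by_contra! hc
  have e1 : ∀ i, B i x y = 0 := fun i => h1 y hy.2.1 i x hx
  have e1' : ∀ i, B i y x = 0 := fun i => (hB i y x).trans (e1 i)
  have e2 := hc (y + x) (U.add_mem hy.1 (hXU hx)) (fun i => by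
    have := hxy i
    simp only [Pi.neg_apply] at this
    simp [e1, e1', this])
  have e3 := hc (y - x) (U.sub_mem hy.1 (hXU hx)) (fun i => by
    have := hxy i
    simp only [Pi.neg_apply] at this
    simp [e1, e1', this])
  have e4 := h2 y hy.2.2 x hx x hx
  have e5 : T x y x = 0 := by rw [hT2, e4]
  have e6 : T y x x = 0 := by rw [hT1, e5]
  simp only [map_add, map_sub, LinearMap.add_apply, LinearMap.sub_apply, e4, e5, e6] at e2 e3
  have : (2 : k) * T y y y = 0 := by linear_combination e2 + e3
  exact hTy ((mul_eq_zero.mp this).resolve_left hk2)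

/-- prescribed values for independent quadratic forms -/
theorem exists_quad_values [IsAlgClosed k] (hk2 : (2 : k) ≠ 0) {ι : Type*} [Fintype ι]
    (T : V →ₗ[k] V →ₗ[k] V →ₗ[k] k) (hT2 : ∀ x y z, T x y z = T x z y)
    (v : ι → V) (hv : LinearIndependent k fun i => (V0 T).mkQ (v i))
    {U : Submodule k V} (hU : FC U) (r : ι → k) : ∃ x ∈ U, ∀ i, T (v i) x x = r i := by
  obtain ⟨X, L, hXU, hX, hL, h⟩ := core (fun i => T (v i)) (fun i x y => hT2 _ _ _) U
  obtain ⟨U1, hU1, h1⟩ := FC_orth_family hX (fun i => T (v i))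
  suffices hLtop : r ∈ L by
    obtain ⟨x, hx, hr⟩ := hL r hLtop
    exact ⟨x, hXU hx, hr⟩
  by_contra hr
  obtain ⟨f, hf, hfL⟩ := Submodule.exists_dual_map_eq_bot_of_notMem hr inferInstance
  have hfL' : ∀ a ∈ L, f a = 0 := by
    intro a ha
    have : f a ∈ L.map f := Submodule.mem_map_of_mem ha
    rwa [hfL, Submodule.mem_bot] at this
  classical
  set c : ι → k := fun i => f (Pi.single i 1) with hc
  have hfc : ∀ a : ι → k, f a = ∑ i, c i * a i := by
    intro a
    conv_lhs => rw [pi_eq_sum_univ' a]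
    simp only [map_sum, map_smul, smul_eq_mul, hc]
    refine Finset.sum_congr rfl fun i _ => ?_
    rw [mul_comm]
  have hmem : ∑ i, c i • v i ∈ V0 T := by
    rw [mem_V0]
    refine FR_of_vanish hk2 _ (fun x y => hT2 _ _ _) (FC_inf hU hU1) ?_
    intro u hu
    have := hfL' _ (h u hu.1 (h1 u hu.2))
    rw [hfc] at this
    simpa [map_sum, LinearMap.sum_apply] using this
  have hz : ∑ i, c i • (V0 T).mkQ (v i) = 0 := by
    have : (V0 T).mkQ (∑ i, c i • v i) = 0 := by
      rw [← LinearMap.mem_ker, Submodule.ker_mkQ]; exact hmem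
    rw [map_sum] at this
    simpa only [map_smul] using this
  have hc0 := Fintype.linearIndependent_iff.mp hv c hz
  apply hf
  rw [hfc]
  simp [hc0]

theorem exists_values [IsAlgClosed k] (hk2 : (2 : k) ≠ 0) {ι : Type*} [Fintype ι]
    (T : V →ₗ[k] V →ₗ[k] V →ₗ[k] k)
    (hT1 : ∀ x y z, T x y z = T y x z) (hT2 : ∀ x y z, T x y z = T x z y)
    (hT : ∀ U : Submodule k V, FC U → ∃ x ∈ U, T x x x ≠ 0)
    (v : ι → V) (hv : LinearIndependent k fun i => (V0 T).mkQ (v i))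
    {U : Submodule k V} (hU : FC U) (r : ι → k) (c : k) :
    ∃ x ∈ U, (∀ i, T (v i) x x = r i) ∧ T x x x = c := by
  obtain ⟨z, hz, hzr⟩ := exists_quad_values hk2 T hT2 v hv hU r
  have hK : FC (U ⊓ ((⨅ i, LinearMap.ker (T (v i) z)) ⊓ LinearMap.ker (T z z))) :=
    FC_inf hU (FC_inf (FC_iInf fun i => FC_ker _) (FC_ker _))
  obtain ⟨y, hy, hyq, hyT⟩ := exists_zero_quad hk2 (fun o : Option ι => T (o.elim z v))
    (fun i x y => hT2 _ _ _) T hT1 hT2 hT hK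
  obtain ⟨s, hs⟩ := IsAlgClosed.exists_pow_nat_eq ((c - T z z z) / T y y y) (n := 3) (by norm_num)
  have a1 : ∀ i, T (v i) z y = 0 := fun i => (Submodule.mem_iInf _).mp hy.2.1 i
  have a1' : ∀ i, T (v i) y z = 0 := fun i => by rw [hT2, a1]
  have a2 : ∀ i, T (v i) y y = 0 := fun i => hyq (some i)
  have a3 : T z y y = 0 := hyq none
  have a4 : T z z y = 0 := hy.2.2
  have a5 : T z y z = 0 := by rw [hT2, a4]
  have a6 : T y z z = 0 := by rw [hT1, a5]
  have a7 : T y z y = 0 := by rw [hT1, a3]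
  have a8 : T y y z = 0 := by rw [hT2, a7]
  refine ⟨z + s • y, U.add_mem hz (U.smul_mem _ hy.1), fun i => ?_, ?_⟩
  · simp [a1, a1', a2, hzr]
  · simp only [map_add, LinearMap.add_apply, map_smul, LinearMap.smul_apply, smul_eq_mul, a3, a4,
      a5, a6, a7, a8]
    have : s ^ 3 * T y y y = c - T z z z := by rw [hs]; field_simp
    linear_combination this

/-- common isotropic vectors avoiding a subspace of infinite codimension -/
theorem exists_iso_avoid [IsAlgClosed k] {ι : Type*} [Finite ι]
    (B : ι → V →ₗ[k] V →ₗ[k] k) (hB : ∀ i x y, B i x y = B i y x)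
    {U N : Submodule k V} (hU : FC U) (hN : ¬ FC N) : ∃ z ∈ U, z ∉ N ∧ ∀ i, B i z z = 0 := by
  obtain ⟨X, L, hXU, hX, hL, h⟩ := core B hB U
  obtain ⟨U1, hU1, h1⟩ := FC_orth_family hX B
  obtain ⟨y, hy, hyN⟩ := FC_not_le (FC_inf hU hU1) (fun hc => hN (FC_sup_fg hX hc))
  obtain ⟨x, hx, hxy⟩ := hL _ (L.neg_mem (h y hy.1 (h1 y hy.2)))
  have e1 : ∀ i, B i x y = 0 := fun i => h1 y hy.2 i x hx
  have e1' : ∀ i, B i y x = 0 := fun i => (hB i y x).trans (e1 i)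
  refine ⟨y + x, U.add_mem hy.1 (hXU hx), fun hc => hyN ?_, fun i => ?_⟩
  · have := Submodule.add_mem_sup hc (X.neg_mem hx)
    simpa using this
  · have := hxy i
    simp only [Pi.neg_apply] at this
    simp [e1, e1', this]

theorem exists_iso_cubic_avoid [IsAlgClosed k] {ι : Type*} [Finite ι]
    (B : ι → V →ₗ[k] V →ₗ[k] k) (hB : ∀ i x y, B i x y = B i y x)
    (T : V →ₗ[k] V →ₗ[k] V →ₗ[k] k)
    {U N : Submodule k V} (hU : FC U) (hN : ¬ FC N) :
    ∃ z ∈ U, z ∉ N ∧ (∀ i, B i z z = 0) ∧ T z z z = 0 := by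
  obtain ⟨z1, hz1, hz1N, hz1B⟩ := exists_iso_avoid B hB hU hN
  have hU2 : FC (U ⊓ ⨅ i, LinearMap.ker (B i z1)) := FC_inf hU (FC_iInf fun i => FC_ker _)
  obtain ⟨z2, hz2, hz2N, hz2B⟩ := exists_iso_avoid B hB hU2
    (fun hc => hN (FC_sup_fg (Submodule.fg_span_singleton z1) hc))
  have e1 : ∀ i, B i z1 z2 = 0 := fun i => (Submodule.mem_iInf _).mp hz2.2 i
  have e1' : ∀ i, B i z2 z1 = 0 := fun i => (hB i _ _).trans (e1 i)
  by_cases h0 : T z2 z2 z2 = 0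
  · exact ⟨z2, hz2.1, fun h => hz2N (Submodule.mem_sup_left h), hz2B, h0⟩
  open Polynomial in
  obtain ⟨t, ht⟩ := IsAlgClosed.exists_root
    (C (T z2 z2 z2) * X ^ 3 + C (T z1 z2 z2 + T z2 z1 z2 + T z2 z2 z1) * X ^ 2 +
      C (T z1 z1 z2 + T z1 z2 z1 + T z2 z1 z1) * X + C (T z1 z1 z1)) (by
      rw [Polynomial.degree_cubic h0]; norm_num)
  refine ⟨z1 + t • z2, U.add_mem hz1 (U.smul_mem _ hz2.1), fun hc => ?_, fun i => ?_, ?_⟩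
  · by_cases ht0 : t = 0
    · rw [ht0, zero_smul, add_zero] at hc
      exact hz1N hc
    · apply hz2N
      have h1 : z2 = t⁻¹ • (z1 + t • z2) + (-t⁻¹) • z1 := by
        rw [smul_add, smul_smul, inv_mul_cancel₀ ht0]; module
      rw [h1]
      exact Submodule.add_mem_sup (N.smul_mem _ hc)
        (Submodule.smul_mem _ _ (Submodule.mem_span_singleton_self _))
  · simp [e1, e1', hz1B, hz2B]
  · simp only [Polynomial.IsRoot.def, Polynomial.eval_add, Polynomial.eval_mul,
      Polynomial.eval_C, Polynomial.eval_pow, Polynomial.eval_X] at ht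
    simp only [map_add, LinearMap.add_apply, map_smul, LinearMap.smul_apply, smul_eq_mul]
    linear_combination ht

theorem exists_values_avoid [IsAlgClosed k] (hk2 : (2 : k) ≠ 0) {ι : Type*} [Fintype ι]
    (T : V →ₗ[k] V →ₗ[k] V →ₗ[k] k)
    (hT1 : ∀ x y z, T x y z = T y x z) (hT2 : ∀ x y z, T x y z = T x z y)
    (hT : ∀ U : Submodule k V, FC U → ∃ x ∈ U, T x x x ≠ 0)
    (v : ι → V) (hv : LinearIndependent k fun i => (V0 T).mkQ (v i))
    {U N : Submodule k V} (hU : FC U) (hN : ¬ FC N) (r : ι → k) (c : k) :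
    ∃ x ∈ U, x ∉ N ∧ (∀ i, T (v i) x x = r i) ∧ T x x x = c := by
  obtain ⟨z, hz, hzr, hzc⟩ := exists_values hk2 T hT1 hT2 hT v hv hU r c
  by_cases hzN : z ∉ N
  · exact ⟨z, hz, hzN, hzr, hzc⟩
  rw [not_not] at hzN
  have hK : FC (U ⊓ ((⨅ i, LinearMap.ker (T (v i) z)) ⊓ LinearMap.ker (T z z))) :=
    FC_inf hU (FC_inf (FC_iInf fun i => FC_ker _) (FC_ker _))
  obtain ⟨y, hy, hyN, hyq, hyT⟩ := exists_iso_cubic_avoid (fun o : Option ι => T (o.elim z v))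
    (fun i x y => hT2 _ _ _) T hK hN
  have a1 : ∀ i, T (v i) z y = 0 := fun i => (Submodule.mem_iInf _).mp hy.2.1 i
  have a1' : ∀ i, T (v i) y z = 0 := fun i => by rw [hT2, a1]
  have a2 : ∀ i, T (v i) y y = 0 := fun i => hyq (some i)
  have a3 : T z y y = 0 := hyq none
  have a4 : T z z y = 0 := hy.2.2
  have a5 : T z y z = 0 := by rw [hT2, a4]
  have a6 : T y z z = 0 := by rw [hT1, a5]
  have a7 : T y z y = 0 := by rw [hT1, a3]
  have a8 : T y y z = 0 := by rw [hT2, a7]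
  refine ⟨z + y, U.add_mem hz hy.1, fun h => hyN ?_, fun i => ?_, ?_⟩
  · have := N.sub_mem h hzN
    simpa using this
  · simp [a1, a1', a2, hzr]
  · simp only [map_add, LinearMap.add_apply, a3, a4, a5, a6, a7, a8, hzc, hyT]
    ring

end Core

/-! ### Locally finite sums of powers of linear forms -/

section PowerSums
variable {k W : Type*} [Field k] [AddCommGroup W] [Module k W]

theorem flatten {α : Type*} [Countable α] (G : W →ₗ[k] (α →₀ (ℕ →₀ k))) :
    ∃ m : W →ₗ[k] (ℕ →₀ k), (∀ x, G x = 0 → m x = 0) ∧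
      ∀ (d : ℕ), ∀ x, (m x).sum (fun _ c => c ^ d) =
        (G x).sum fun _ f => f.sum fun _ c => c ^ d := by
  obtain ⟨g, hg⟩ := Countable.exists_injective_nat (α × ℕ)
  refine ⟨Finsupp.lmapDomain k k g ∘ₗ (Finsupp.curryLinearEquiv k).symm.toLinearMap ∘ₗ G,
    fun x hx => by simp only [LinearMap.comp_apply, hx, map_zero], fun d x => ?_⟩
  simp only [LinearMap.comp_apply, Finsupp.lmapDomain_apply]
  rw [Finsupp.sum_mapDomain_index_inj hg]
  exact Finsupp.sum_uncurry_index' (G x) (fun _ _ c => c ^ d)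

theorem locFin {M : Type*} [AddCommGroup M] [Module k M] (b : Module.Basis ℕ k W)
    (g : ℕ → W →ₗ[k] M) (hg : ∀ i j, j < i → g i (b j) = 0) :
    ∃ G : W →ₗ[k] (ℕ →₀ M), ∀ x i, G x i = g i x := by
  classical
  let G : W →ₗ[k] (ℕ →₀ M) := b.constr k fun j =>
    ∑ i ∈ Finset.range (j + 1), Finsupp.single i (g i (b j))
  refine ⟨G, fun x i => ?_⟩
  have : Finsupp.lapply i ∘ₗ G = g i := by
    refine b.ext fun j => ?_
    simp only [LinearMap.comp_apply, Finsupp.lapply_apply, G, Module.Basis.constr_basis,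
      Finsupp.finsetSum_apply, Finsupp.single_apply]
    rw [Finset.sum_ite_eq' ]
    split_ifs with h
    · rfl
    · rw [hg i j]
      simpa using h
  exact LinearMap.congr_fun this x

/-- sums of `d`-th powers of a locally finite family of linear forms vanishing on `K` -/
def PS (d : ℕ) (K : Submodule k W) : Set (W → k) :=
  {f | ∃ m : W →ₗ[k] (ℕ →₀ k), (∀ x ∈ K, m x = 0) ∧ ∀ x, f x = (m x).sum fun _ c => c ^ d}

theorem PS_zero (d : ℕ) (K : Submodule k W) : (fun _ => 0) ∈ PS d K :=
  ⟨0, fun _ _ => rfl, fun x => by simp⟩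

theorem PS_add {d : ℕ} {K : Submodule k W} {f g : W → k} (hf : f ∈ PS d K) (hg : g ∈ PS d K) :
    (fun x => f x + g x) ∈ PS d K := by
  obtain ⟨m, hm, hfm⟩ := hf
  obtain ⟨n, hn, hgn⟩ := hg
  obtain ⟨p, hp, hp2⟩ := flatten ((Finsupp.linearEquivFunOnFinite k (ℕ →₀ k) (Fin 2)).symm.toLinearMap
    ∘ₗ LinearMap.pi ![m, n])
  refine ⟨p, fun x hx => hp x ?_, fun x => ?_⟩
  · ext i
    fin_cases i <;> simp [Finsupp.linearEquivFunOnFinite, hm x hx, hn x hx]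
  · rw [hp2, Finsupp.sum_fintype _ _ (by simp)]
    simp [Fin.sum_univ_two, hfm, hgn, Finsupp.linearEquivFunOnFinite]

theorem PS_smul [IsAlgClosed k] {d : ℕ} (hd : 0 < d) {K : Submodule k W} {f : W → k} (c : k)
    (hf : f ∈ PS d K) :
    (fun x => c * f x) ∈ PS d K := by
  obtain ⟨m, hm, hfm⟩ := hf
  obtain ⟨s, rfl⟩ := IsAlgClosed.exists_pow_nat_eq c hd
  refine ⟨s • m, fun x hx => by simp [hm x hx], fun x => ?_⟩
  change s ^ d * f x = _
  rw [LinearMap.smul_apply, Finsupp.sum_smul_index (by simp [hd.ne']), hfm, Finsupp.mul_sum]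
  simp [mul_pow]

theorem PS_sum {d : ℕ} {K : Submodule k W} {ι : Type*} (s : Finset ι)
    {f : ι → W → k} (hf : ∀ i ∈ s, f i ∈ PS d K) :
    (fun x => ∑ i ∈ s, f i x) ∈ PS d K := by
  classical
  induction s using Finset.induction_on with
  | empty => simpa using PS_zero d K
  | insert a s ha ih =>
    simp only [Finset.sum_insert ha]
    exact PS_add (hf a (Finset.mem_insert_self _ _))
      (ih fun i hi => hf i (Finset.mem_insert_of_mem hi))

theorem PS_pow {d : ℕ} (hd : 0 < d) {K : Submodule k W} (l : W →ₗ[k] k) (hl : ∀ x ∈ K, l x = 0) :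
    (fun x => l x ^ d) ∈ PS d K :=
  ⟨Finsupp.lsingle 0 ∘ₗ l, fun x hx => by simp [hl x hx], fun x => by
    simp [Finsupp.sum_single_index, hd.ne']⟩

theorem PS_comp {d : ℕ} {K K' : Submodule k W} {f : W → k} (hf : f ∈ PS d K) (P : W →ₗ[k] W)
    (hP : ∀ x ∈ K', P x = 0) : (fun x => f (P x)) ∈ PS d K' := by
  obtain ⟨m, hm, hfm⟩ := hf
  exact ⟨m ∘ₗ P, fun x hx => by simp [hP x hx], fun x => by simp [hfm]⟩

theorem PS_mul2 [IsAlgClosed k] (hk2 : (2 : k) ≠ 0) {K : Submodule k W} (l m : W →ₗ[k] k)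
    (hl : ∀ x ∈ K, l x = 0) (hm : ∀ x ∈ K, m x = 0) :
    (fun x => l x * m x) ∈ PS 2 K := by
  have h := PS_add (PS_smul two_pos (4⁻¹ : k) (PS_pow two_pos (K := K) (l + m)
      (fun x hx => by simp [hl x hx, hm x hx])))
    (PS_smul two_pos (-4⁻¹ : k) (PS_pow two_pos (K := K) (l - m)
      (fun x hx => by simp [hl x hx, hm x hx])))
  convert h using 2 with x
  have h4 : (4 : k) ≠ 0 := by
    have : (4 : k) = 2 * 2 := by norm_num
    rw [this]; exact mul_ne_zero hk2 hk2
  simp only [LinearMap.add_apply, LinearMap.sub_apply]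
  field_simp
  ring

theorem PS_mul3' [IsAlgClosed k] (hk2 : (2 : k) ≠ 0) (hk3 : (3 : k) ≠ 0) {K : Submodule k W}
    (a l : W →ₗ[k] k) (ha : ∀ x ∈ K, a x = 0) (hl : ∀ x ∈ K, l x = 0) :
    (fun x => a x * l x ^ 2) ∈ PS 3 K := by
  have h := PS_add (PS_smul three_pos (6⁻¹ : k) (PS_pow three_pos (K := K) (a + l)
      (fun x hx => by simp [hl x hx, ha x hx])))
    (PS_add (PS_smul three_pos (6⁻¹ : k) (PS_pow three_pos (K := K) (a - l)
      (fun x hx => by simp [hl x hx, ha x hx])))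
      (PS_smul three_pos (-3⁻¹ : k) (PS_pow three_pos (K := K) a ha)))
  convert h using 2 with x
  have h6 : (6 : k) = 2 * 3 := by norm_num
  simp only [LinearMap.add_apply, LinearMap.sub_apply]
  rw [h6]
  field_simp
  ring

theorem PS_mul3 [IsAlgClosed k] (hk2 : (2 : k) ≠ 0) (hk3 : (3 : k) ≠ 0) {K : Submodule k W}
    (a l m : W →ₗ[k] k) (ha : ∀ x ∈ K, a x = 0) (hl : ∀ x ∈ K, l x = 0) (hm : ∀ x ∈ K, m x = 0) :
    (fun x => a x * (l x * m x)) ∈ PS 3 K := by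
  have h := PS_add (PS_smul three_pos (4⁻¹ : k) (PS_mul3' hk2 hk3 (K := K) a (l + m) ha
      (fun x hx => by simp [hl x hx, hm x hx])))
    (PS_smul three_pos (-4⁻¹ : k) (PS_mul3' hk2 hk3 (K := K) a (l - m) ha
      (fun x hx => by simp [hl x hx, hm x hx])))
  convert h using 2 with x
  have h4 : (4 : k) ≠ 0 := by
    have : (4 : k) = 2 * 2 := by norm_num
    rw [this]; exact mul_ne_zero hk2 hk2
  simp only [LinearMap.add_apply, LinearMap.sub_apply]
  field_simp
  ring

/-- span of the first basis vectors -/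
def Klt (b : Module.Basis ℕ k W) (i : ℕ) : Submodule k W := Submodule.span k (b '' Set.Iio i)

theorem mem_Klt (b : Module.Basis ℕ k W) {i j : ℕ} (h : j < i) : b j ∈ Klt b i :=
  Submodule.subset_span ⟨j, h, rfl⟩

theorem Klt_mono (b : Module.Basis ℕ k W) {i j : ℕ} (h : i ≤ j) : Klt b i ≤ Klt b j :=
  Submodule.span_mono (Set.image_mono (Set.Iio_subset_Iio h))

theorem exists_Klt (b : Module.Basis ℕ k W) (x : W) : ∃ N, x ∈ Klt b N := by
  refine ⟨(b.repr x).support.sup id + 1, ?_⟩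
  have h : Finsupp.linearCombination k b (b.repr x) ∈ Klt b ((b.repr x).support.sup id + 1) := ?_
  · rwa [b.linearCombination_repr] at h
  rw [Finsupp.linearCombination_apply]
  refine Submodule.sum_mem _ fun i hi => Submodule.smul_mem _ _ (mem_Klt b ?_)
  exact Nat.lt_succ_of_le (Finset.le_sup (f := id) hi)

theorem Klt_kill {M : Type*} [AddCommGroup M] [Module k M] (b : Module.Basis ℕ k W) {i : ℕ}
    (f : W →ₗ[k] M) (h : ∀ j < i, f (b j) = 0) : ∀ x ∈ Klt b i, f x = 0 := by
  intro x hx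
  have : Klt b i ≤ LinearMap.ker f := by
    refine Submodule.span_le.mpr ?_
    rintro _ ⟨j, hj, rfl⟩
    exact h j hj
  exact this hx

theorem coord_kill (b : Module.Basis ℕ k W) (i : ℕ) : ∀ x ∈ Klt b i, b.coord i x = 0 :=
  Klt_kill b _ fun j hj => by simp [hj.ne]

/-- truncation -/
noncomputable def Pge (b : Module.Basis ℕ k W) (i : ℕ) : W →ₗ[k] W :=
  b.constr k fun j => if i ≤ j then b j else 0

theorem Pge_basis (b : Module.Basis ℕ k W) (i j : ℕ) :
    Pge b i (b j) = if i ≤ j then b j else 0 := by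
  simp [Pge, Module.Basis.constr_basis]

theorem Pge_zero (b : Module.Basis ℕ k W) (x : W) : Pge b 0 x = x := by
  have : Pge b 0 = LinearMap.id := b.ext fun j => by simp [Pge_basis]
  rw [this]; rfl

theorem Pge_kill (b : Module.Basis ℕ k W) (i : ℕ) : ∀ x ∈ Klt b i, Pge b i x = 0 :=
  Klt_kill b _ fun j hj => by simp [Pge_basis, hj]

theorem Pge_succ (b : Module.Basis ℕ k W) (i : ℕ) (x : W) :
    Pge b i x = b.coord i x • b i + Pge b (i + 1) x := by
  have : Pge b i = (b.coord i).smulRight (b i) + Pge b (i + 1) := b.ext fun j => by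
    rcases lt_trichotomy i j with h | h | h
    · have h1 : i ≤ j := h.le
      have h2 : i + 1 ≤ j := h
      simp [Pge_basis, h1, h2, h.ne']
    · subst h; simp [Pge_basis]
    · have h1 : ¬ i ≤ j := by omega
      have h2 : ¬ i + 1 ≤ j := by omega
      simp [Pge_basis, h1, h2, h.ne]
  rw [this]; simp

theorem Pge_comp (b : Module.Basis ℕ k W) (i : ℕ) (x : W) :
    Pge b (i + 1) (Pge b i x) = Pge b (i + 1) x := by
  have : Pge b (i + 1) ∘ₗ Pge b i = Pge b (i + 1) := b.ext fun j => by
    by_cases h : i ≤ j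
    · simp [Pge_basis, h]
    · have h2 : ¬ i + 1 ≤ j := by omega
      simp [Pge_basis, h, h2]
  exact LinearMap.congr_fun this x

theorem Pge_kill' (b : Module.Basis ℕ k W) (i : ℕ) : ∀ x ∈ Klt b i, Pge b (i + 1) x = 0 :=
  fun x hx => Pge_kill b _ x (Klt_mono b (Nat.le_succ i) hx)

theorem PS_locFin {d : ℕ} (b : Module.Basis ℕ k W) {F : W → k} {f : ℕ → W → k}
    (hf : ∀ i, f i ∈ PS d (Klt b i))
    (hF : ∀ N, ∀ x ∈ Klt b N, F x = ∑ i ∈ Finset.range N, f i x) : F ∈ PS d ⊥ := by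
  choose m hm hfm using hf
  obtain ⟨G, hG⟩ := locFin b m (fun i j hij => hm i _ (mem_Klt b hij))
  obtain ⟨p, hp, hp2⟩ := flatten G
  refine ⟨p, fun x hx => by rw [(Submodule.mem_bot k).mp hx, map_zero], fun x => ?_⟩
  obtain ⟨N, hN⟩ := exists_Klt b x
  rw [hp2, hF N x hN, Finsupp.sum_of_support_subset (s := Finset.range N)]
  · exact Finset.sum_congr rfl fun i _ => by rw [hG, hfm]
  · intro i hi
    rw [Finset.mem_range]
    by_contra h
    rw [Finsupp.mem_support_iff, hG] at hi
    exact hi (hm i x (Klt_mono b (by omega) hN))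
  · simp

theorem PS_bilin [IsAlgClosed k] (hk2 : (2 : k) ≠ 0) (b : Module.Basis ℕ k W)
    (B : W →ₗ[k] W →ₗ[k] k) : (fun x => B x x) ∈ PS 2 (⊥ : Submodule k W) := by
  refine PS_locFin b (f := fun i x =>
    B (Pge b i x) (Pge b i x) - B (Pge b (i + 1) x) (Pge b (i + 1) x)) (fun i => ?_) ?_
  · have := PS_mul2 hk2 (K := Klt b i) (b.coord i)
      (B (b i) ∘ₗ Pge b i + B.flip (b i) ∘ₗ Pge b (i + 1)) (coord_kill b i)
      (fun x hx => by simp [Pge_kill b i x hx, Pge_kill' b i x hx])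
    convert this using 2 with x
    rw [Pge_succ b i x]
    simp only [map_add, LinearMap.add_apply, map_smul, LinearMap.smul_apply, smul_eq_mul,
      LinearMap.comp_apply, LinearMap.flip_apply, Pge_succ b i x]
    ring
  · intro N x hx
    rw [Finset.sum_range_sub' (fun i => B (Pge b i x) (Pge b i x)), Pge_zero, Pge_kill b N x hx]
    simp

theorem cubic_telescope (b : Module.Basis ℕ k W) (H : W →ₗ[k] W →ₗ[k] W →ₗ[k] k)
    (hH1 : ∀ x y z, H x y z = H y x z) (hH2 : ∀ x y z, H x y z = H x z y) (N : ℕ) (x : W)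
    (hx : x ∈ Klt b N) : H x x x = ∑ i ∈ Finset.range N, b.coord i x *
      (H (b i) (Pge b i x) (Pge b i x) + H (b i) (Pge b i x) (Pge b (i + 1) x) +
        H (b i) (Pge b (i + 1) x) (Pge b (i + 1) x)) := by
  have h := Finset.sum_range_sub' (fun i => H (Pge b i x) (Pge b i x) (Pge b i x)) N
  rw [Pge_zero, Pge_kill b N x hx] at h
  simp only [map_zero, sub_zero] at h
  rw [← h]
  refine Finset.sum_congr rfl fun i _ => ?_
  rw [Pge_succ b i x]
  set q := Pge b (i + 1) x
  set e := b i
  have e1 : H q e e = H e e q := by rw [hH1, hH2]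
  have e2 : H e q e = H e e q := hH2 _ _ _
  have e3 : H q e q = H e q q := hH1 _ _ _
  have e4 : H q q e = H e q q := by rw [hH2, hH1]
  simp only [map_add, LinearMap.add_apply, map_smul, LinearMap.smul_apply, smul_eq_mul,
    e1, e2, e3, e4]
  ring

theorem PS_trilin [IsAlgClosed k] (hk2 : (2 : k) ≠ 0) (hk3 : (3 : k) ≠ 0) (b : Module.Basis ℕ k W)
    (H : W →ₗ[k] W →ₗ[k] W →ₗ[k] k)
    (hH1 : ∀ x y z, H x y z = H y x z) (hH2 : ∀ x y z, H x y z = H x z y)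
    (hH : ∀ w, FC (LinearMap.ker (H w))) : (fun x => H x x x) ∈ PS 3 (⊥ : Submodule k W) := by
  refine PS_locFin b (fun i => ?_) (cubic_telescope b H hH1 hH2)
  obtain ⟨n, c, l, hcl⟩ := FC_decomp (hH (b i))
  have key : ∀ x y, H (b i) x y = ∑ t, l t x * H (b i) (c t) y := by
    intro x y
    have := LinearMap.congr_fun (LinearMap.mem_ker.mp (hcl x)) y
    simp only [map_sub, map_sum, map_smul, LinearMap.sub_apply, LinearMap.sum_apply,
      LinearMap.smul_apply, smul_eq_mul, LinearMap.zero_apply] at this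
    exact sub_eq_zero.mp this
  have hp : ∀ P Q : W →ₗ[k] W, (∀ x ∈ Klt b i, P x = 0) → (∀ x ∈ Klt b i, Q x = 0) →
      (fun x => b.coord i x * H (b i) (P x) (Q x)) ∈ PS 3 (Klt b i) := by
    intro P Q hP hQ
    have := PS_sum (K := Klt b i) (d := 3) Finset.univ
      (f := fun t x => b.coord i x * ((l t ∘ₗ P) x * (H (b i) (c t) ∘ₗ Q) x))
      (fun t _ => PS_mul3 hk2 hk3 _ _ _ (coord_kill b i) (fun x hx => by simp [hP x hx])
        (fun x hx => by simp [hQ x hx]))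
    convert this using 2 with x
    rw [key, Finset.mul_sum]
    rfl
  have h := PS_add (PS_add (hp _ _ (Pge_kill b i) (Pge_kill b i))
    (hp _ _ (Pge_kill b i) (Pge_kill' b i))) (hp _ _ (Pge_kill' b i) (Pge_kill' b i))
  convert h using 2 with x
  ring

end PowerSums

/-! ### Frames -/

section Frames
variable {k V W : Type*} [Field k] [AddCommGroup V] [Module k V] [AddCommGroup W] [Module k W]

theorem polar6 (R : V →ₗ[k] V →ₗ[k] V →ₗ[k] k)
    (h1 : ∀ x y z, R x y z = R y x z) (h2 : ∀ x y z, R x y z = R x z y) (x y z : V) :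
    6 * R x y z = R (x + y + z) (x + y + z) (x + y + z) - R (x + y) (x + y) (x + y)
      - R (y + z) (y + z) (y + z) - R (x + z) (x + z) (x + z) + R x x x + R y y y + R z z z := by
  have e1 : R x z y = R x y z := (h2 _ _ _).symm
  have e2 : R y x z = R x y z := h1 _ _ _
  have e3 : R y z x = R x y z := by rw [h2, h1]
  have e4 : R z x y = R x y z := by rw [h1, ← h2]
  have e5 : R z y x = R x y z := by rw [h1, h2, h1]
  simp only [map_add, LinearMap.add_apply, e1, e2, e3, e4, e5]
  ring

theorem polarize (hk2 : (2 : k) ≠ 0) (hk3 : (3 : k) ≠ 0)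
    (T : V →ₗ[k] V →ₗ[k] V →ₗ[k] k)
    (hT1 : ∀ x y z, T x y z = T y x z) (hT2 : ∀ x y z, T x y z = T x z y)
    (S : W →ₗ[k] W →ₗ[k] W →ₗ[k] k)
    (hS1 : ∀ x y z, S x y z = S y x z) (hS2 : ∀ x y z, S x y z = S x z y)
    (φ : W →ₗ[k] V) (h : ∀ x, T (φ x) (φ x) (φ x) = S x x x) (x y z : W) :
    T (φ x) (φ y) (φ z) = S x y z := by
  have a := polar6 T hT1 hT2 (φ x) (φ y) (φ z)
  have b := polar6 S hS1 hS2 x y z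
  simp only [← map_add, h] at a
  rw [← b] at a
  have h6 : (6 : k) ≠ 0 := by
    have : (6 : k) = 2 * 3 := by norm_num
    rw [this]; exact mul_ne_zero hk2 hk3
  exact mul_left_cancel₀ h6 a

theorem frame_expand {J ι : Type*} (T : V →ₗ[k] V →ₗ[k] V →ₗ[k] k)
    (hT1 : ∀ x y z, T x y z = T y x z) (hT2 : ∀ x y z, T x y z = T x z y)
    (v : J → V) (e : ι → V) (t : J → ι → k) (c : ι → k)
    (h1 : ∀ i j s, T (v i) (v j) (e s) = 0)
    (h2 : ∀ i s s', s ≠ s' → T (v i) (e s) (e s') = 0)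
    (h3 : ∀ i s, T (v i) (e s) (e s) = t i s)
    (h4 : ∀ s s' s'', s ≠ s' → T (e s) (e s') (e s'') = 0)
    (h5 : ∀ s, T (e s) (e s) (e s) = c s) (a : J →₀ k) (m : ι →₀ k) (x : V)
    (hx : x = Finsupp.linearCombination k v a + Finsupp.linearCombination k e m) :
    T x x x = T (Finsupp.linearCombination k v a) (Finsupp.linearCombination k v a)
      (Finsupp.linearCombination k v a) +
      m.sum fun s z => 3 * z ^ 2 * (a.sum fun j y => y * t j s) + z ^ 3 * c s := by
  classical
  subst hx
  set x0 := Finsupp.linearCombination k v a with hx0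
  have hx0' : x0 = ∑ j ∈ a.support, a j • v j := by
    rw [hx0, Finsupp.linearCombination_apply]; rfl
  have g2 : ∀ s s', s ≠ s' → T x0 (e s) (e s') = 0 := by
    intro s s' hs
    simp [hx0', LinearMap.sum_apply, h2 _ s s' hs]
  have g1 : ∀ s, T x0 x0 (e s) = 0 := by
    intro s
    simp [hx0', LinearMap.sum_apply, h1]
  have g3 : ∀ s, T x0 (e s) (e s) = a.sum fun j y => y * t j s := by
    intro s
    simp [hx0', LinearMap.sum_apply, h3, Finsupp.sum]
  have main : ∀ A : Finset ι, T (x0 + ∑ s ∈ A, m s • e s) (x0 + ∑ s ∈ A, m s • e s)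
      (x0 + ∑ s ∈ A, m s • e s) = T x0 x0 x0 +
        ∑ s ∈ A, (3 * m s ^ 2 * (a.sum fun j y => y * t j s) + m s ^ 3 * c s) := by
    intro A
    induction A using Finset.induction_on with
    | empty => simp
    | insert r A hr ih =>
      rw [Finset.sum_insert hr, Finset.sum_insert hr]
      have hne : ∀ s ∈ A, s ≠ r := fun s hs h => hr (h ▸ hs)
      set y := x0 + ∑ s ∈ A, m s • e s with hy
      have f1 : T y y (e r) = 0 := by
        have b1 : T x0 (∑ s ∈ A, m s • e s) (e r) = 0 := by
          rw [map_sum, LinearMap.sum_apply]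
          exact Finset.sum_eq_zero fun s hs => by simp [g2 s r (hne s hs)]
        have b2 : T (∑ s ∈ A, m s • e s) (∑ s ∈ A, m s • e s) (e r) = 0 := by
          simp only [map_sum, LinearMap.sum_apply]
          refine Finset.sum_eq_zero fun s hs => Finset.sum_eq_zero fun s' hs' => ?_
          have : T (e s') (e s) (e r) = 0 := by
            rw [hT2, hT1, h4 _ _ _ (hne s' hs').symm]
          have : T (e s) (e s') (e r) = 0 := by rw [hT1, this]
          simp_all
        rw [hy]
        simp only [map_add, LinearMap.add_apply, g1, b1, b2]
        rw [hT1, b1]; simp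
      have f2 : T y (e r) (e r) = a.sum fun j y => y * t j r := by
        rw [hy]
        simp only [map_add, LinearMap.add_apply, g3, map_sum, LinearMap.sum_apply]
        rw [Finset.sum_eq_zero (s := A), add_zero]
        intro s hs
        simp [h4 _ _ (e r |> fun _ => r) (hne s hs)]
      have f3 : T y (e r) y = 0 := by rw [hT2, f1]
      have f4 : T (e r) y y = 0 := by rw [hT1, f3]
      have f5 : T (e r) y (e r) = T y (e r) (e r) := hT1 _ _ _
      have f6 : T (e r) (e r) y = T y (e r) (e r) := by rw [hT2, f5]
      have : x0 + (m r • e r + ∑ s ∈ A, m s • e s) = y + m r • e r := by rw [hy]; abel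
      rw [this]
      simp only [map_add, LinearMap.add_apply, map_smul, LinearMap.smul_apply, smul_eq_mul,
        f1, f3, f4, f5, f6, f2, h5]
      rw [ih]
      ring
  have := main m.support
  rw [Finsupp.linearCombination_apply]
  exact this

theorem exists_seq {α : Type*} [Nonempty α] (Q : ℕ → (ℕ → α) → α → Prop)
    (hloc : ∀ n f g y, (∀ m < n, f m = g m) → Q n f y → Q n g y)
    (h : ∀ n f, (∀ m < n, Q m f (f m)) → ∃ y, Q n f y) : ∃ f : ℕ → α, ∀ n, Q n f (f n) := by
  classical
  let F : ℕ → ℕ → α := fun n => Nat.rec (fun _ => Classical.arbitrary α)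
    (fun n f => Function.update f n (Classical.epsilon (Q n f))) n
  have hF : ∀ n, F (n + 1) = Function.update (F n) n (Classical.epsilon (Q n (F n))) := fun n => rfl
  have hstep : ∀ m n, m < n → F n m = F (m + 1) m := by
    intro m n hmn
    induction n, hmn using Nat.le_induction with
    | base => rfl
    | succ n hn ih =>
      rw [hF n, Function.update_of_ne (by omega), ih]
  refine ⟨fun n => F (n + 1) n, fun n => ?_⟩
  induction n using Nat.strong_induction_on with
  | _ n ih =>
    have hl : ∀ m < n, F n m = F (m + 1) m := fun m hm => hstep m n hm
    have hex : ∃ y, Q n (F n) y := by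
      refine h n (F n) fun m hm => ?_
      rw [hl m hm]
      exact hloc m _ _ _ (fun i hi => (hl i (by omega)).symm) (ih m hm)
    have := Classical.epsilon_spec hex
    refine hloc n _ _ _ hl ?_
    simp only [hF n, Function.update_self]
    exact this

theorem finite_frame [IsAlgClosed k] (hk2 : (2 : k) ≠ 0) {ι : Type*} [Fintype ι]
    (T : V →ₗ[k] V →ₗ[k] V →ₗ[k] k)
    (hT1 : ∀ x y z, T x y z = T y x z) (hT2 : ∀ x y z, T x y z = T x z y)
    (hT : ∀ U : Submodule k V, FC U → ∃ x ∈ U, T x x x ≠ 0) (h0 : FC (V0 T))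
    (v : ι → V) (hv : LinearIndependent k fun i => (V0 T).mkQ (v i))
    (t : ι → ℕ → k) (c : ℕ → k) : ∃ e : ℕ → V,
      (∀ i j s, T (v i) (v j) (e s) = 0) ∧
      (∀ i s, T (v i) (e s) (e s) = t i s) ∧
      (∀ s s', s ≠ s' → T (e s) (e s') = 0) ∧
      (∀ s, T (e s) (e s) (e s) = c s) := by
  obtain ⟨e, he⟩ := exists_seq (fun n (f : ℕ → V) y => y ∈ V0 T ∧ (∀ i j, T (v i) (v j) y = 0) ∧
    (∀ m < n, T (f m) y = 0) ∧ (∀ i, T (v i) y y = t i n) ∧ T y y y = c n) (by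
      rintro n f g y hfg ⟨a1, a2, a3, a4, a5⟩
      exact ⟨a1, a2, fun m hm => by rw [← hfg m hm]; exact a3 m hm, a4, a5⟩) (by
      intro n f hf
      have hU : FC (V0 T ⊓ ((⨅ i, ⨅ j, LinearMap.ker (T (v i) (v j))) ⊓
          ⨅ m : Fin n, LinearMap.ker (T (f m)))) :=
        FC_inf h0 (FC_inf (FC_iInf fun i => FC_iInf fun j => FC_ker _)
          (FC_iInf fun m => (hf m m.2).1))
      obtain ⟨y, hy, hy1, hy2⟩ := exists_values hk2 T hT1 hT2 hT v hv hU (fun i => t i n) (c n)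
      refine ⟨y, hy.1, fun i j => ?_, fun m hm => ?_, hy1, hy2⟩
      · exact (Submodule.mem_iInf _).mp ((Submodule.mem_iInf _).mp hy.2.1 i) j
      · exact (Submodule.mem_iInf _).mp hy.2.2 ⟨m, hm⟩)
  refine ⟨e, fun i j s => (he s).2.1 i j, fun i s => (he s).2.2.2.1 i, fun s s' hs => ?_,
    fun s => (he s).2.2.2.2⟩
  rcases lt_or_gt_of_ne hs with h | h
  · exact (he s').2.2.1 s h
  · have := (he s).2.2.1 s' h
    ext z
    rw [hT1, this]

theorem linIndep_seq (N : Submodule k V) (f : ℕ → V) (n : ℕ)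
    (h : ∀ m < n, f m ∉ N ⊔ Submodule.span k (f '' Set.Iio m)) :
    LinearIndependent k fun i : Fin n => N.mkQ (f i) := by
  induction n with
  | zero => exact linearIndependent_empty_type
  | succ n ih =>
    rw [linearIndependent_finSucc']
    refine ⟨ih fun m hm => h m (by omega), fun hc => h n (by omega) ?_⟩
    have h1 : Submodule.span k (Set.range (Fin.init fun i : Fin (n + 1) => N.mkQ (f i))) ≤
        (Submodule.span k (f '' Set.Iio n)).map N.mkQ := by
      rw [Submodule.span_le]
      rintro _ ⟨i, rfl⟩
      exact Submodule.mem_map_of_mem (Submodule.subset_span ⟨i, i.2, rfl⟩)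
    obtain ⟨y, hy, hyn⟩ := h1 hc
    have : f n - y ∈ N := by
      rw [← N.ker_mkQ, LinearMap.mem_ker, map_sub, hyn]
      simp
    have h2 := Submodule.add_mem_sup this hy
    simpa using h2

theorem infinite_seq [IsAlgClosed k] (hk2 : (2 : k) ≠ 0)
    (T : V →ₗ[k] V →ₗ[k] V →ₗ[k] k)
    (hT1 : ∀ x y z, T x y z = T y x z) (hT2 : ∀ x y z, T x y z = T x z y)
    (hT : ∀ U : Submodule k V, FC U → ∃ x ∈ U, T x x x ≠ 0) (h0 : ¬ FC (V0 T))
    (t : ℕ → ℕ → k) (c : ℕ → k) : ∃ u : ℕ → V,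
      (∀ n, ∀ i < n, ∀ j < n, T (u i) (u j) (u n) = 0) ∧
      (∀ n, ∀ i < n, T (u i) (u n) (u n) = t i n) ∧
      (∀ n, T (u n) (u n) (u n) = c n) := by
  obtain ⟨e, he⟩ := exists_seq (fun n (f : ℕ → V) y =>
    (∀ i < n, ∀ j < n, T (f i) (f j) y = 0) ∧ (∀ i < n, T (f i) y y = t i n) ∧ T y y y = c n ∧
      y ∉ V0 T ⊔ Submodule.span k (f '' Set.Iio n)) (by
      rintro n f g y hfg ⟨a1, a2, a3, a4⟩
      refine ⟨fun i hi j hj => ?_, fun i hi => ?_, a3, ?_⟩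
      · rw [← hfg i hi, ← hfg j hj]; exact a1 i hi j hj
      · rw [← hfg i hi]; exact a2 i hi
      · have : g '' Set.Iio n = f '' Set.Iio n :=
          Set.image_congr fun i hi => (hfg i hi).symm
        rwa [this]) (by
      intro n f hf
      have hU : FC (⨅ i : Fin n, ⨅ j : Fin n, LinearMap.ker (T (f i) (f j))) :=
        FC_iInf fun i => FC_iInf fun j => FC_ker _
      have hli := linIndep_seq (V0 T) f n fun m hm => (hf m hm).2.2.2
      have hN : ¬ FC (V0 T ⊔ Submodule.span k (f '' Set.Iio n)) := fun hc =>
        h0 (FC_sup_fg (Submodule.fg_span ((Set.finite_Iio n).image f)) hc)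
      obtain ⟨y, hy, hyN, hy1, hy2⟩ := exists_values_avoid hk2 T hT1 hT2 hT _ hli hU hN
        (fun i => t i n) (c n)
      refine ⟨y, fun i hi j hj => ?_, fun i hi => hy1 ⟨i, hi⟩, hy2, hyN⟩
      exact (Submodule.mem_iInf _).mp ((Submodule.mem_iInf _).mp hy ⟨i, hi⟩) ⟨j, hj⟩)
  exact ⟨e, fun n => (he n).1, fun n => (he n).2.1, fun n => (he n).2.2.1⟩

end Frames

/-! ### The infinite residual rank case -/

section Infinite
variable {k V W : Type*} [Field k] [AddCommGroup V] [Module k V] [AddCommGroup W] [Module k W]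

theorem infinite_frame [IsAlgClosed k] (hk2 : (2 : k) ≠ 0)
    (T : V →ₗ[k] V →ₗ[k] V →ₗ[k] k)
    (hT1 : ∀ x y z, T x y z = T y x z) (hT2 : ∀ x y z, T x y z = T x z y)
    (hT : ∀ U : Submodule k V, FC U → ∃ x ∈ U, T x x x ≠ 0) (h0 : ¬ FC (V0 T)) (z : k) :
    ∃ (v : ℕ → V) (e : ℕ × ℕ → V),
      (∀ i j l, T (v i) (v j) (v l) = 0) ∧
      (∀ i j s, T (v i) (v j) (e s) = 0) ∧
      (∀ i s s', s ≠ s' → T (v i) (e s) (e s') = 0) ∧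
      (∀ i s, T (v i) (e s) (e s) = if i = s.1 then z else 0) ∧
      (∀ s s' s'', s ≠ s' → T (e s) (e s') (e s'') = 0) ∧
      (∀ s, T (e s) (e s) (e s) = 0) := by
  let t : ℕ → ℕ → k := fun i n =>
    if n % 2 = 1 ∧ i = 2 * (Nat.unpair (n / 2)).1 then z else 0
  have ht0 : ∀ i n, n % 2 = 0 → t i n = 0 := fun i n h => by
    simp only [t]; rw [if_neg]; omega
  have ht1 : ∀ i n, i % 2 = 1 → t i n = 0 := fun i n h => by
    simp only [t]; rw [if_neg]; omega
  obtain ⟨u, hu1, hu2, hu3⟩ := infinite_seq hk2 T hT1 hT2 hT h0 t (fun _ => 0)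
  have H : ∀ a b c, (a < b → b = c → t a b = 0) → (b < a → a = c → t b a = 0) →
      (c < a → a = b → t c a = 0) → T (u a) (u b) (u c) = 0 := by
    intro a b c g1 g2 g3
    rcases lt_trichotomy a b with hab | hab | hab
    · rcases lt_trichotomy b c with hbc | hbc | hbc
      · exact hu1 c a (by omega) b hbc
      · subst hbc; rw [hu2 b a hab, g1 hab rfl]
      · rw [hT2]; exact hu1 b a hab c hbc
    · subst hab
      rcases lt_trichotomy a c with hac | hac | hac
      · exact hu1 c a hac a hac
      · subst hac; exact hu3 a
      · rw [hT2, hT1, hT2, hT1, hT2, hT1, hT2, hT1, hT2, hT1, hT2]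
        first
        | (rw [hu2 a c hac, g3 hac rfl])
        | (rw [hT1, hu2 a c hac, g3 hac rfl])
        | (rw [hT2, hT1, hu2 a c hac, g3 hac rfl])
    · rcases lt_trichotomy a c with hac | hac | hac
      · exact hu1 c a hac b (by omega)
      · subst hac; rw [hT1, hu2 a b hab, g2 hab rfl]
      · rw [hT1, hT2]; exact hu1 a b hab c hac
  have hp : ∀ s s' : ℕ × ℕ, s ≠ s' → Nat.pair s.1 s.2 ≠ Nat.pair s'.1 s'.2 := by
    intro s s' h h'
    rw [Nat.pair_eq_pair] at h'
    exact h (Prod.ext h'.1 h'.2)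
  refine ⟨fun j => u (2 * j), fun s => u (2 * Nat.pair s.1 s.2 + 1), ?_, ?_, ?_, ?_, ?_, ?_⟩
  · intro i j l
    exact H _ _ _ (fun _ _ => ht0 _ _ (by omega)) (fun _ _ => ht0 _ _ (by omega))
      (fun _ _ => ht0 _ _ (by omega))
  · intro i j s
    exact H _ _ _ (fun _ _ => ht0 _ _ (by omega)) (fun _ _ => ht0 _ _ (by omega))
      (fun _ _ => ht0 _ _ (by omega))
  · intro i s s' hs
    have := hp s s' hs
    exact H _ _ _ (fun _ _ => by omega) (fun _ _ => by omega) (fun _ _ => by omega)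
  · intro i s
    by_cases h : 2 * i < 2 * Nat.pair s.1 s.2 + 1
    · show T (u _) (u _) (u _) = _
      rw [hu2 _ _ h]
      simp only [t]
      have h1 : (2 * Nat.pair s.1 s.2 + 1) % 2 = 1 := by omega
      have h2 : (2 * Nat.pair s.1 s.2 + 1) / 2 = Nat.pair s.1 s.2 := by omega
      rw [h1, h2, Nat.unpair_pair]
      congr 1
      simp
    · have := Nat.left_le_pair s.1 s.2
      rw [if_neg (by omega)]
      exact H _ _ _ (fun _ _ => by omega) (fun _ _ => by omega) (fun _ _ => by omega)
  · intro s s' s'' hs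
    have := hp s s' hs
    exact H _ _ _ (fun _ _ => ht1 _ _ (by omega)) (fun _ _ => ht1 _ _ (by omega))
      (fun _ _ => ht1 _ _ (by omega))
  · intro s
    exact hu3 _

theorem embed_infinite [IsAlgClosed k] (hk2 : (2 : k) ≠ 0) (hk3 : (3 : k) ≠ 0)
    (T : V →ₗ[k] V →ₗ[k] V →ₗ[k] k)
    (hT1 : ∀ x y z, T x y z = T y x z) (hT2 : ∀ x y z, T x y z = T x z y)
    (hT : ∀ U : Submodule k V, FC U → ∃ x ∈ U, T x x x ≠ 0) (h0 : ¬ FC (V0 T))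
    (S : W →ₗ[k] W →ₗ[k] W →ₗ[k] k)
    (hS1 : ∀ x y z, S x y z = S y x z) (hS2 : ∀ x y z, S x y z = S x z y)
    (b : Module.Basis ℕ k W) :
    ∃ φ : W →ₗ[k] V, ∀ x y z, T (φ x) (φ y) (φ z) = S x y z := by
  obtain ⟨v, e, h00, h1, h2, h3, h4, h5⟩ := infinite_frame hk2 T hT1 hT2 hT h0 3⁻¹
  have hR : ∀ i, (fun x => S (b i) (Pge b i x) (Pge b i x) +
      S (b i) (Pge b i x) (Pge b (i + 1) x) + S (b i) (Pge b (i + 1) x) (Pge b (i + 1) x))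
      ∈ PS 2 (Klt b i) := by
    intro i
    have := PS_comp (PS_bilin hk2 b (S (b i) + (S (b i)).compl₂ (Pge b (i + 1)) +
      (S (b i)).compl₁₂ (Pge b (i + 1)) (Pge b (i + 1)))) (Pge b i) (Pge_kill b i)
    simpa only [LinearMap.add_apply, LinearMap.compl₂_apply, LinearMap.compl₁₂_apply, Pge_comp]
      using this
  choose m hm hRm using hR
  obtain ⟨G, hG⟩ := locFin b m (fun i j hij => hm i _ (mem_Klt b hij))
  let M : W →ₗ[k] (ℕ × ℕ →₀ k) := (Finsupp.curryLinearEquiv k).symm.toLinearMap ∘ₗ G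
  let φ : W →ₗ[k] V := Finsupp.linearCombination k v ∘ₗ b.repr.toLinearMap +
    Finsupp.linearCombination k e ∘ₗ M
  refine ⟨φ, polarize hk2 hk3 T hT1 hT2 S hS1 hS2 φ fun x => ?_⟩
  rw [frame_expand T hT1 hT2 v e _ _ h1 h2 h3 h4 h5 (b.repr x) (M x) (φ x) rfl]
  have z1 : T (Finsupp.linearCombination k v (b.repr x)) (Finsupp.linearCombination k v (b.repr x))
      (Finsupp.linearCombination k v (b.repr x)) = 0 := by
    rw [Finsupp.linearCombination_apply, Finsupp.sum]
    simp [LinearMap.sum_apply, h00]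
  rw [z1, zero_add]
  have z2 : ∀ s : ℕ × ℕ, ((b.repr x).sum fun j y => y * if j = s.1 then (3⁻¹ : k) else 0)
      = b.coord s.1 x * 3⁻¹ := by
    intro s
    rw [Finsupp.sum_eq_single s.1]
    · simp
    · intro j _ hj; simp [hj]
    · simp
  simp only [z2]
  have z3 : ∀ (s : ℕ × ℕ) (z : k), 3 * z ^ 2 * (b.coord s.1 x * 3⁻¹) + z ^ 3 * 0 =
      b.coord s.1 x * z ^ 2 := by
    intro s z; field_simp; ring
  simp only [z3]
  have z4 : ((M x).sum fun s z => b.coord s.1 x * z ^ 2) =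
      (G x).sum fun i f => f.sum fun _ z => b.coord i x * z ^ 2 :=
    Finsupp.sum_uncurry_index' (G x) (fun i _ z => b.coord i x * z ^ 2)
  rw [z4]
  obtain ⟨N, hN⟩ := exists_Klt b x
  rw [cubic_telescope b S hS1 hS2 N x hN, Finsupp.sum_of_support_subset (s := Finset.range N)]
  · refine Finset.sum_congr rfl fun i _ => ?_
    have := hRm i x
    simp only at this
    rw [this, hG, Finsupp.mul_sum]
  · intro i hi
    rw [Finset.mem_range]
    by_contra h
    rw [Finsupp.mem_support_iff, hG] at hi
    exact hi (hm i x (Klt_mono b (by omega) hN))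
  · simp

end Infinite

/-! ### The finite residual rank case -/

section Finite
variable {k V W : Type*} [Field k] [AddCommGroup V] [Module k V] [AddCommGroup W] [Module k W]

theorem tri_sum {r : ℕ} (R : V →ₗ[k] V →ₗ[k] V →ₗ[k] k)
    (h1 : ∀ x y z, R x y z = R y x z) (h2 : ∀ x y z, R x y z = R x z y)
    (a : Fin r → k) (y : Fin r → V) :
    R (∑ j, a j • y j) (∑ j, a j • y j) (∑ j, a j • y j) =
      ∑ i, ∑ j, ∑ l, R (y i) (y j) (y l) * (a i * (a j * a l)) := by
  simp only [map_sum, LinearMap.sum_apply, map_smul, LinearMap.smul_apply, smul_eq_mul,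
    Finset.mul_sum]
  refine Finset.sum_congr rfl fun i _ => Finset.sum_congr rfl fun j _ =>
    Finset.sum_congr rfl fun l _ => ?_
  have : R (y l) (y j) (y i) = R (y i) (y j) (y l) := by rw [h1, h2, h1]
  rw [this]
  ring

theorem embed_finite [IsAlgClosed k] (hk2 : (2 : k) ≠ 0) (hk3 : (3 : k) ≠ 0)
    (T : V →ₗ[k] V →ₗ[k] V →ₗ[k] k)
    (hT1 : ∀ x y z, T x y z = T y x z) (hT2 : ∀ x y z, T x y z = T x z y)
    (hT : ∀ U : Submodule k V, FC U → ∃ x ∈ U, T x x x ≠ 0) (h0 : FC (V0 T))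
    (S : W →ₗ[k] W →ₗ[k] W →ₗ[k] k)
    (hS1 : ∀ x y z, S x y z = S y x z) (hS2 : ∀ x y z, S x y z = S x z y)
    (b : Module.Basis ℕ k W) (h0' : FC (V0 S))
    (hr : Module.finrank k (V ⧸ V0 T) = Module.finrank k (W ⧸ V0 S)) :
    ∃ φ : W →ₗ[k] V, ∀ x y z, T (φ x) (φ y) (φ z) = S x y z := by
  classical
  have i1 : Module.Finite k (V ⧸ V0 T) := h0
  have i2 : Module.Finite k (W ⧸ V0 S) := h0'
  obtain ⟨r, ⟨bW⟩, ⟨bV⟩⟩ : ∃ r : ℕ, Nonempty (Module.Basis (Fin r) k (W ⧸ V0 S)) ∧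
      Nonempty (Module.Basis (Fin r) k (V ⧸ V0 T)) :=
    ⟨_, ⟨Module.finBasis k (W ⧸ V0 S)⟩, ⟨(Module.finBasis k (V ⧸ V0 T)).reindex (finCongr hr)⟩⟩
  choose v hv using fun i => (V0 T).mkQ_surjective (bV i)
  choose w hw using fun i => (V0 S).mkQ_surjective (bW i)
  let a : Fin r → W →ₗ[k] k := fun j => bW.coord j ∘ₗ (V0 S).mkQ
  let pr : W →ₗ[k] W := LinearMap.id - ∑ j, (a j).smulRight (w j)
  have hpr : ∀ x, x = ∑ j, a j x • w j + pr x := by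
    intro x
    simp [pr, LinearMap.sum_apply]
  have hpr0 : ∀ x, pr x ∈ V0 S := by
    intro x
    refine (Submodule.Quotient.mk_eq_zero _).mp ?_
    change (V0 S).mkQ _ = 0
    have := congrArg (V0 S).mkQ (hpr x)
    rw [map_add, map_sum] at this
    simp only [map_smul, hw, a, LinearMap.comp_apply, Module.Basis.coord_apply, bW.sum_repr] at this
    exact left_eq_add.mp this
  have hvl : LinearIndependent k fun i => (V0 T).mkQ (v i) := by
    simp only [hv]; exact bV.linearIndependent
  -- the quadratic parts
  have hQ : ∀ j, (fun x => S (w j) (pr x) (pr x)) ∈ PS 2 (⊥ : Submodule k W) := by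
    intro j
    simpa only [LinearMap.compl₁₂_apply] using PS_bilin hk2 b ((S (w j)).compl₁₂ pr pr)
  choose mQ _ hmQ using hQ
  -- the residual cubic
  have hH : (fun x => (∑ i, ∑ j, ∑ l, (S (w i) (w j) (w l) - T (v i) (v j) (v l)) *
      (a i x * (a j x * a l x))) + (∑ i, ∑ j, 3 * (a i x * (a j x * S (w i) (w j) (pr x)))) +
      S (pr x) (pr x) (pr x)) ∈ PS 3 (⊥ : Submodule k W) := by
    have z : ∀ l : W →ₗ[k] k, ∀ x ∈ (⊥ : Submodule k W), l x = 0 := by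
      intro l x hx
      rw [(Submodule.mem_bot k).mp hx, map_zero]
    refine PS_add (PS_add ?_ ?_) ?_
    · exact PS_sum _ fun i _ => PS_sum _ fun j _ => PS_sum _ fun l _ =>
        PS_smul three_pos _ (PS_mul3 hk2 hk3 (a i) (a j) (a l) (z _) (z _) (z _))
    · exact PS_sum _ fun i _ => PS_sum _ fun j _ =>
        PS_smul three_pos _ (PS_mul3 hk2 hk3 (a i) (a j) (S (w i) (w j) ∘ₗ pr) (z _) (z _) (z _))
    · let H : W →ₗ[k] W →ₗ[k] W →ₗ[k] k := LinearMap.mk₂ k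
        (fun x y => S (pr x) (pr y) ∘ₗ pr)
        (by intros; ext; simp) (by intros; ext; simp) (by intros; ext; simp)
        (by intros; ext; simp)
      have hHa : ∀ x y z, H x y z = S (pr x) (pr y) (pr z) := fun x y z => rfl
      refine PS_trilin hk2 hk3 b H (fun x y z => hS1 _ _ _) (fun x y z => hS2 _ _ _) fun x => ?_
      refine FC_mono ?_ (FC_comap (mem_V0.mp (hpr0 x)) pr)
      intro y hy
      rw [Submodule.mem_comap, LinearMap.mem_ker] at hy
      rw [LinearMap.mem_ker]
      ext z
      rw [hHa, hy]; rfl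
  obtain ⟨mH, _, hmH⟩ := hH
  -- the frame
  obtain ⟨g, hg⟩ := Countable.exists_injective_nat (Option (Fin r) × ℕ)
  have hgi := Function.leftInverse_invFun hg
  let t : Fin r → Option (Fin r) × ℕ → k := fun j s => if s.1 = some j then 1 else 0
  let c : Option (Fin r) × ℕ → k := fun s => if s.1 = none then 1 else 0
  obtain ⟨e', e1, e2, e3, e4⟩ := finite_frame hk2 T hT1 hT2 hT h0 v hvl
    (fun j n => t j (Function.invFun g n)) (fun n => c (Function.invFun g n))
  let e : Option (Fin r) × ℕ → V := fun s => e' (g s)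
  have f1 : ∀ i j s, T (v i) (v j) (e s) = 0 := fun i j s => e1 i j _
  have f4' : ∀ s s', s ≠ s' → T (e s) (e s') = 0 := fun s s' h => e3 _ _ fun hc => h (hg hc)
  have f4 : ∀ s s' s'', s ≠ s' → T (e s) (e s') (e s'') = 0 := fun s s' s'' h => by
    rw [f4' s s' h]; rfl
  have f2 : ∀ i s s', s ≠ s' → T (v i) (e s) (e s') = 0 := fun i s s' h => by
    rw [hT1, hT2, f4' s s' h]; rfl
  have f3 : ∀ i s, T (v i) (e s) (e s) = t i s := fun i s => by
    simp only [e, e2, hgi s]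
  have f5 : ∀ s, T (e s) (e s) (e s) = c s := fun s => by
    simp only [e, e4, hgi s]
  let G : W →ₗ[k] (Option (Fin r) →₀ (ℕ →₀ k)) :=
    (Finsupp.linearEquivFunOnFinite k (ℕ →₀ k) (Option (Fin r))).symm.toLinearMap ∘ₗ
      LinearMap.pi fun o => o.elim mH mQ
  have hG : ∀ x o, G x o = (o.elim mH mQ : W →ₗ[k] (ℕ →₀ k)) x := fun x o => rfl
  let M : W →ₗ[k] (Option (Fin r) × ℕ →₀ k) := (Finsupp.curryLinearEquiv k).symm.toLinearMap ∘ₗ G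
  let A : W →ₗ[k] (Fin r →₀ k) := bW.repr.toLinearMap ∘ₗ (V0 S).mkQ
  have hA : ∀ x j, A x j = a j x := fun x j => rfl
  let φ : W →ₗ[k] V := Finsupp.linearCombination k v ∘ₗ A + Finsupp.linearCombination k e ∘ₗ M
  refine ⟨φ, polarize hk2 hk3 T hT1 hT2 S hS1 hS2 φ fun x => ?_⟩
  rw [frame_expand T hT1 hT2 v e _ _ f1 f2 f3 f4 f5 (A x) (M x) (φ x) rfl]
  have z0 : Finsupp.linearCombination k v (A x) = ∑ j, a j x • v j := by
    rw [Finsupp.linearCombination_apply, Finsupp.sum_fintype _ _ (by simp)]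
    rfl
  have z2 : ∀ s, ((A x).sum fun j y => y * t j s) = ∑ j, a j x * t j s := by
    intro s
    rw [Finsupp.sum_fintype _ _ (by simp)]
    rfl
  simp only [z2]
  have z4 : ((M x).sum fun s z => 3 * z ^ 2 * (∑ j, a j x * t j s) + z ^ 3 * c s) =
      (G x).sum fun o f => f.sum fun s z => 3 * z ^ 2 * (∑ j, a j x * t j (o, s)) + z ^ 3 * c (o, s) :=
    Finsupp.sum_uncurry_index' (G x)
      (fun o s z => 3 * z ^ 2 * (∑ j, a j x * t j (o, s)) + z ^ 3 * c (o, s))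
  rw [z4, Finsupp.sum_fintype _ _ (by simp), Fintype.sum_option]
  have z5 : ((G x none).sum fun s z => 3 * z ^ 2 * (∑ j, a j x * t j (none, s)) +
      z ^ 3 * c (none, s)) = (mH x).sum fun _ z => z ^ 3 := by
    rw [hG]
    simp [t, c]
  have z6 : ∀ i : Fin r, ((G x (some i)).sum fun s z => 3 * z ^ 2 * (∑ j, a j x * t j (some i, s)) +
      z ^ 3 * c (some i, s)) = 3 * (a i x * S (w i) (pr x) (pr x)) := by
    intro i
    have := hmQ i x
    simp only at this
    rw [this, hG]
    simp only [t, c, Option.elim, Option.some.injEq, mul_ite, mul_one, mul_zero,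
      Finset.sum_ite_eq, Finset.mem_univ, if_true, reduceCtorEq, if_false, add_zero]
    rw [Finsupp.mul_sum, Finsupp.mul_sum]
    refine Finsupp.sum_congr fun s _ => ?_
    ring
  rw [z5, ← hmH]
  simp only [z6]
  rw [z0]
  have z7 : S x x x = S (∑ j, a j x • w j) (∑ j, a j x • w j) (∑ j, a j x • w j) +
      3 * S (∑ j, a j x • w j) (∑ j, a j x • w j) (pr x) +
      3 * S (∑ j, a j x • w j) (pr x) (pr x) + S (pr x) (pr x) (pr x) := by
    conv_lhs => rw [hpr x]
    set p := ∑ j, a j x • w j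
    set q := pr x
    have e1 : S q p p = S p p q := by rw [hS1, hS2]
    have e2 : S p q p = S p p q := hS2 _ _ _
    have e3 : S q p q = S p q q := hS1 _ _ _
    have e4 : S q q p = S p q q := by rw [hS2, hS1]
    simp only [map_add, LinearMap.add_apply, e1, e2, e3, e4]
    ring
  have z8 : S (∑ j, a j x • w j) (∑ j, a j x • w j) (pr x) =
      ∑ i, ∑ j, (a i x * (a j x * S (w i) (w j) (pr x))) := by
    simp only [map_sum, LinearMap.sum_apply, map_smul, LinearMap.smul_apply, smul_eq_mul,
      Finset.mul_sum]
    refine Finset.sum_congr rfl fun i _ => Finset.sum_congr rfl fun j _ => ?_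
    rw [hS1]
  have z9 : S (∑ j, a j x • w j) (pr x) (pr x) = ∑ i, a i x * S (w i) (pr x) (pr x) := by
    simp only [map_sum, LinearMap.sum_apply, map_smul, LinearMap.smul_apply, smul_eq_mul]
  rw [z7, z8, z9, tri_sum S hS1 hS2, tri_sum T hT1 hT2]
  simp only [sub_mul, Finset.sum_sub_distrib, ← Finset.mul_sum]
  ring

end Finite

/-! ### Bridges to the frozen definitions -/

section Bridges
variable {k : Type u} {V : Type v} {W : Type w} [Field k] [AddCommGroup V] [Module k V]
  [AddCommGroup W] [Module k W]

theorem nondeg_bridge (T : V →ₗ[k] V →ₗ[k] V →ₗ[k] k)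
    (hT1 : ∀ x y z, T x y z = T y x z) (hT2 : ∀ x y z, T x y z = T x z y)
    (hV : ¬ FiniteStrengthCubic k T) : ∀ U : Submodule k V, FC U → ∃ x ∈ U, T x x x ≠ 0 := by
  intro U hU
  by_contra hc
  push Not at hc
  apply hV
  obtain ⟨n, c, l, hcl⟩ := FC_decomp hU
  let C : V →ₗ[k] V := ∑ i, (l i).smulRight (c i)
  have hC : ∀ x, C x = ∑ i, l i x • c i := fun x => by simp [C, LinearMap.sum_apply]
  let D : V →ₗ[k] V := LinearMap.id - C
  have hD : ∀ x, D x ∈ U := fun x => by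
    have := hcl x
    rw [← hC] at this
    exact this
  have hx : ∀ x, x = D x + C x := fun x => by simp [D]
  refine ⟨n, l, fun i => LinearMap.BilinMap.toQuadraticMap
    ((3 : k) • (T (c i)).compl₁₂ D D + (3 : k) • (T (c i)).compl₁₂ D C + (T (c i)).compl₁₂ C C),
    fun x => ?_⟩
  simp only [LinearMap.BilinMap.toQuadraticMap_apply, LinearMap.add_apply, LinearMap.smul_apply,
    LinearMap.compl₁₂_apply, smul_eq_mul]
  have z : ∀ y z, T (C x) y z = ∑ i, l i x * T (c i) y z := by
    intro y z
    simp [hC, LinearMap.sum_apply]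
  have : T x x x = 3 * T (C x) (D x) (D x) + 3 * T (C x) (D x) (C x) + T (C x) (C x) (C x) := by
    conv_lhs => rw [hx x]
    have h0 := hc _ (hD x)
    set p := C x
    set q := D x
    have e1 : T q p p = T p q p := hT1 _ _ _
    have e2 : T p p q = T p q p := hT2 _ _ _
    have e3 : T q p q = T p q q := hT1 _ _ _
    have e4 : T q q p = T p q q := by rw [hT2, hT1]
    simp only [map_add, LinearMap.add_apply, e1, e2, e3, e4, h0]
    ring
  rw [this, z, z, z, Finset.mul_sum, Finset.mul_sum, ← Finset.sum_add_distrib,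
    ← Finset.sum_add_distrib]
  refine Finset.sum_congr rfl fun i _ => ?_
  ring

theorem fQuad_mem (hk2 : (2 : k) ≠ 0) (hk3 : (3 : k) ≠ 0) (T : V →ₗ[k] V →ₗ[k] V →ₗ[k] k)
    (hT2 : ∀ x y z, T x y z = T x z y) (v : V) :
    fQuad T v ∈ FinStrength k V ↔ v ∈ V0 T := by
  constructor
  · rintro ⟨n, l, m, h⟩
    refine FR_of_vanish hk2 (T v) (hT2 v) (U := ⨅ i, LinearMap.ker (l i))
      (FC_iInf fun i => FC_ker _) fun x hx => ?_
    have h1 := h x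
    have h2 : ∀ i, l i x = 0 := fun i => (Submodule.mem_iInf _).mp hx i
    simp only [fQuad, LinearMap.BilinMap.toQuadraticMap_apply, LinearMap.smul_apply, smul_eq_mul,
      h2, zero_mul, Finset.sum_const_zero] at h1
    exact (mul_eq_zero.mp h1).resolve_left hk3
  · intro hv
    obtain ⟨n, c, l, hcl⟩ := FC_decomp (mem_V0.mp hv)
    refine ⟨n, l, fun i => (3 : k) • T v (c i), fun x => ?_⟩
    have h1 := LinearMap.congr_fun (LinearMap.mem_ker.mp (hcl x)) x
    simp only [map_sub, map_sum, map_smul, LinearMap.sub_apply, LinearMap.sum_apply,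
      LinearMap.smul_apply, smul_eq_mul, LinearMap.zero_apply] at h1
    simp only [fQuad, LinearMap.BilinMap.toQuadraticMap_apply, LinearMap.smul_apply, smul_eq_mul]
    rw [sub_eq_zero.mp h1, Finset.mul_sum]
    refine Finset.sum_congr rfl fun i _ => ?_
    ring

theorem rrk_eq_rank (hk2 : (2 : k) ≠ 0) (hk3 : (3 : k) ≠ 0) (T : V →ₗ[k] V →ₗ[k] V →ₗ[k] k)
    (hT2 : ∀ x y z, T x y z = T x z y) :
    rrk k T = Cardinal.lift.{u} (Module.rank k (V ⧸ V0 T)) := by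
  let f : V →ₗ[k] QuadraticForm k V :=
    { toFun := fQuad T
      map_add' := fun x y => by
        ext z
        simp [fQuad]
      map_smul' := fun c x => by
        ext z
        simp [fQuad]
        ring }
  let δ : V →ₗ[k] (QuadraticForm k V ⧸ FinStrength k V) := (FinStrength k V).mkQ ∘ₗ f
  have hker : LinearMap.ker δ = V0 T := by
    ext v
    rw [LinearMap.mem_ker, ← fQuad_mem hk2 hk3 T hT2]
    exact Submodule.Quotient.mk_eq_zero _
  have hspan : Submodule.span k
      (Set.range fun v => Submodule.Quotient.mk (p := FinStrength k V) (fQuad T v)) =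
      LinearMap.range δ := by
    have : (Set.range fun v => Submodule.Quotient.mk (p := FinStrength k V) (fQuad T v)) =
        (LinearMap.range δ : Set _) := rfl
    rw [this, Submodule.span_eq]
  unfold rrk
  rw [hspan]
  have h := (δ.quotKerEquivRange).lift_rank_eq
  rw [hker] at h
  have h2 : Cardinal.lift.{v} (Module.rank k (LinearMap.range δ)) =
    Module.rank k (LinearMap.range δ) := Cardinal.lift_id'.{v, max u v} _
  rw [h2] at h
  rw [← h]
  exact Cardinal.lift_umax.{v, u} ▸ rfl

theorem rank_le_of_embed (T : V →ₗ[k] V →ₗ[k] V →ₗ[k] k) (S : W →ₗ[k] W →ₗ[k] W →ₗ[k] k)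
    (φ : W →ₗ[k] V) (h : ∀ x y z, T (φ x) (φ y) (φ z) = S x y z) :
    Cardinal.lift.{v} (Module.rank k (W ⧸ V0 S)) ≤
      Cardinal.lift.{w} (Module.rank k (V ⧸ V0 T)) := by
  have hle : (V0 T).comap φ ≤ V0 S := by
    intro x hx
    refine FC_mono ?_ (FC_comap (mem_V0.mp hx) φ)
    intro y hy
    rw [Submodule.mem_comap, LinearMap.mem_ker] at hy
    rw [LinearMap.mem_ker]
    ext z
    rw [← h, hy]; rfl
  have h1 : Module.rank k (W ⧸ V0 S) ≤ Module.rank k (W ⧸ (V0 T).comap φ) :=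
    (Submodule.factor hle).rank_le_of_surjective (Submodule.factor_surjective hle)
  refine (Cardinal.lift_le.mpr h1).trans ?_
  refine LinearMap.lift_rank_le_of_injective (Submodule.mapQ _ _ φ le_rfl) ?_
  rw [← LinearMap.ker_eq_bot, Submodule.ker_mapQ]
  simp

theorem exists_basis (T : V →ₗ[k] V →ₗ[k] V →ₗ[k] k)
    (hT : ∀ U : Submodule k V, FC U → ∃ x ∈ U, T x x x ≠ 0)
    (hdim : Module.rank k V ≤ Cardinal.aleph0) : Nonempty (Module.Basis ℕ k V) := by
  have hnf : ¬ Module.Finite k V := by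
    intro hf
    have : FC (⊥ : Submodule k V) := by
      unfold FC
      infer_instance
    obtain ⟨x, hx, hx0⟩ := hT ⊥ this
    rw [(Submodule.mem_bot k).mp hx] at hx0
    simp at hx0
  have hrk : Module.rank k V = Cardinal.aleph0 := by
    refine le_antisymm hdim ?_
    by_contra h
    exact hnf (Module.rank_lt_aleph0_iff.mp (not_le.mp h))
  let b := Module.Basis.ofVectorSpace k V
  have hb : Cardinal.mk (Module.Basis.ofVectorSpaceIndex k V) = Cardinal.aleph0 := by
    rw [b.mk_eq_rank'', hrk]
  obtain ⟨e⟩ := Cardinal.denumerable_iff.mpr hb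
  exact ⟨b.reindex (Denumerable.eqv _)⟩

end Bridges

/-- Two non-degenerate cubic spaces of countable dimension over an
algebraically closed field of characteristic `≠ 2, 3` are isogenous (each embeds into
the other) iff they have the same residual rank. -/
theorem cubic_isogenous_iff_rrk_eq
    {k : Type u} {V : Type v} {W : Type w} [Field k] [IsAlgClosed k]
    (hk2 : (2 : k) ≠ 0) (hk3 : (3 : k) ≠ 0)
    [AddCommGroup V] [Module k V] [AddCommGroup W] [Module k W]
    (T : V →ₗ[k] V →ₗ[k] V →ₗ[k] k)
    (hT1 : ∀ x y z, T x y z = T y x z) (hT2 : ∀ x y z, T x y z = T x z y)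
    (hV : ¬ FiniteStrengthCubic k T) (hVdim : Module.rank k V ≤ Cardinal.aleph0)
    (S : W →ₗ[k] W →ₗ[k] W →ₗ[k] k)
    (hS1 : ∀ x y z, S x y z = S y x z) (hS2 : ∀ x y z, S x y z = S x z y)
    (hW : ¬ FiniteStrengthCubic k S) (hWdim : Module.rank k W ≤ Cardinal.aleph0) :
    ((∃ φ : W →ₗ[k] V, ∀ x y z, T (φ x) (φ y) (φ z) = S x y z) ∧
      (∃ ψ : V →ₗ[k] W, ∀ x y z, S (ψ x) (ψ y) (ψ z) = T x y z)) ↔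
      Cardinal.lift.{w} (rrk k T) = Cardinal.lift.{v} (rrk k S) := by
  have hT := nondeg_bridge T hT1 hT2 hV
  have hS := nondeg_bridge S hS1 hS2 hW
  have key : Cardinal.lift.{w} (rrk k T) = Cardinal.lift.{v} (rrk k S) ↔
      Cardinal.lift.{w} (Module.rank k (V ⧸ V0 T)) =
        Cardinal.lift.{v} (Module.rank k (W ⧸ V0 S)) := by
    rw [rrk_eq_rank hk2 hk3 T hT2, rrk_eq_rank hk2 hk3 S hS2, Cardinal.lift_lift,
      Cardinal.lift_lift, ← Cardinal.lift_inj.{max v w, u}, Cardinal.lift_lift, Cardinal.lift_lift]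
  rw [key]
  constructor
  · rintro ⟨⟨φ, hφ⟩, ψ, hψ⟩
    exact le_antisymm (rank_le_of_embed S T ψ hψ) (rank_le_of_embed T S φ hφ)
  · intro heq
    obtain ⟨bV⟩ := exists_basis T hT hVdim
    obtain ⟨bW⟩ := exists_basis S hS hWdim
    have hiff : FC (V0 T) ↔ FC (V0 S) := by
      unfold FC
      rw [← Module.rank_lt_aleph0_iff, ← Module.rank_lt_aleph0_iff,
        ← Cardinal.lift_lt_aleph0.{v, w}, heq, Cardinal.lift_lt_aleph0]
    by_cases h0 : FC (V0 T)
    · have h0' := hiff.mp h0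
      have hr : Module.finrank k (V ⧸ V0 T) = Module.finrank k (W ⧸ V0 S) := by
        have := congrArg Cardinal.toNat heq
        simpa [Module.finrank] using this
      exact ⟨embed_finite hk2 hk3 T hT1 hT2 hT h0 S hS1 hS2 bW h0' hr,
        embed_finite hk2 hk3 S hS1 hS2 hS h0' T hT1 hT2 bV h0 hr.symm⟩
    · have h0' : ¬ FC (V0 S) := fun h => h0 (hiff.mpr h)
      exact ⟨embed_infinite hk2 hk3 T hT1 hT2 hT h0 S hS1 hS2 bW,
        embed_infinite hk2 hk3 S hS1 hS2 hS h0' T hT1 hT2 bV⟩
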